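/- Existence of stationary Mikado flows: Let d ≥ 2 and let Λ ⊂ ℤ^d \ {0} be a finite set. Then there exist constants C_{m,α} > 0 (depending only on d, Λ, m, α) and μ₀ ≥ 1 such that for every μ ≥ μ₀ there is a family of smooth vector fields W_k : 𝕋^d → ℝ^d (k ∈ Λ), each of the form W_k = Ψ_k e_k with Ψ_k : 𝕋^d → ℝ smooth and e_k := k/|k|, satisfying: (i) div W_k = 0; (ii) div(W_k ⊗ W_k) = 0; (iii) ∫_{𝕋^d} W_k ⊗ W_k dx = e_k ⊗ e_k (in particular ‖Ψ_k‖_{L²(𝕋^d)} = 1); (iv) for all m ∈ ℕ₀ and 1 ≤ α ≤ ∞, ‖∇^m W_k‖_{L^α(𝕋^d)} ≤ C_{m,α} μ^{m + (d−1)/2 − (d−1)/α}; (v) for all k ≠ k′ in Λ and 1 ≤ α ≤ ∞, ‖W_k ⊗ W_{k′}‖_{L^α(𝕋^d)} ≤ C_{0,α} μ^{(d−1) − d/α}. -/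

import Mathlib

noncomputable section

open MeasureTheory ENNReal

/-- The unit cube in `ℝ^d`, a fundamental domain for the torus `𝕋^d = ℝ^d/ℤ^d`. -/
def cube (d : ℕ) : Set (Fin d → ℝ) := Set.Icc 0 1

/-- A function on `ℝ^d` is `ℤ^d`-periodic, i.e. descends to the torus `𝕋^d`. -/
def ZPeriodic {d : ℕ} {E : Type*} (f : (Fin d → ℝ) → E) : Prop :=
  ∀ (x : Fin d → ℝ) (k : Fin d → ℤ), f (fun i => x i + (k i : ℝ)) = f x

/-- Partial derivative `∂_j g` of a real-valued function on `ℝ^d`. -/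
def pd {d : ℕ} (j : Fin d) (g : (Fin d → ℝ) → ℝ) (x : Fin d → ℝ) : ℝ :=
  fderiv ℝ g x (Pi.single j 1)

/-- Euclidean norm of an integer vector `k ∈ ℤ^d`. -/
def intVecNorm {d : ℕ} (k : Fin d → ℤ) : ℝ := Real.sqrt (∑ i, ((k i : ℝ)) ^ 2)

/-- The unit vector `e_k = k/|k|` in the direction of `k ∈ ℤ^d`. -/
def unitVec {d : ℕ} (k : Fin d → ℤ) : Fin d → ℝ := fun i => (k i : ℝ) / intVecNorm k

/-! ### Integer linear maps and measure preservation on the torus -/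

/-- The real vector `A x` for an integer matrix `A`. -/
def rs {d : ℕ} (A : Matrix (Fin d) (Fin d) ℤ) (x : Fin d → ℝ) (j : Fin d) : ℝ :=
  ∑ i, (A j i : ℝ) * x i

lemma rs_eq {d : ℕ} (A : Matrix (Fin d) (Fin d) ℤ) (x : Fin d → ℝ) :
    rs A x = (A.map (Int.castRingHom ℝ)).mulVec x := by
  ext j
  simp [rs, Matrix.mulVec, dotProduct]

lemma det_castR {d : ℕ} (A : Matrix (Fin d) (Fin d) ℤ) :
    (A.map (Int.castRingHom ℝ)).det = (A.det : ℝ) := by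
  have := (RingHom.map_det (Int.castRingHom ℝ) A).symm
  simpa using this

lemma rs_inj {d : ℕ} {A : Matrix (Fin d) (Fin d) ℤ} (hA : A.det ≠ 0) {x : Fin d → ℝ}
    (hx : ∀ j, rs A x j = 0) : x = 0 := by
  by_contra hne
  have : (A.map (Int.castRingHom ℝ)).det = 0 :=
    Matrix.exists_mulVec_eq_zero_iff.mp ⟨x, hne, by rw [← rs_eq]; ext j; exact hx j⟩
  rw [det_castR] at this
  exact hA (by exact_mod_cast this)

lemma det_ne_of_rs {d : ℕ} {A : Matrix (Fin d) (Fin d) ℤ}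
    (h : ∀ x : Fin d → ℝ, (∀ j, rs A x j = 0) → x = 0) : A.det ≠ 0 := by
  intro hA
  have : (A.map (Int.castRingHom ℝ)).det = 0 := by rw [det_castR, hA]; simp
  obtain ⟨v, hv, hv0⟩ := Matrix.exists_mulVec_eq_zero_iff.mpr this
  rw [← rs_eq] at hv0
  exact hv (h v fun j => congrFun hv0 j)

lemma rs_surj {d : ℕ} {A : Matrix (Fin d) (Fin d) ℤ} (hA : A.det ≠ 0) (y : Fin d → ℝ) :
    ∃ x, rs A x = y := by
  have h : IsUnit (A.map (Int.castRingHom ℝ)) := by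
    rw [Matrix.isUnit_iff_isUnit_det, det_castR]
    exact isUnit_iff_ne_zero.mpr (by exact_mod_cast hA)
  obtain ⟨x, hx⟩ := Matrix.mulVec_surjective_iff_isUnit.mpr h y
  exact ⟨x, by rw [rs_eq, hx]⟩

lemma rs_add {d : ℕ} (A : Matrix (Fin d) (Fin d) ℤ) (x y : Fin d → ℝ) (j : Fin d) :
    rs A (x + y) j = rs A x j + rs A y j := by
  simp [rs, mul_add, Finset.sum_add_distrib]

lemma rs_smul {d : ℕ} (A : Matrix (Fin d) (Fin d) ℤ) (c : ℝ) (y : Fin d → ℝ) (j : Fin d) :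
    rs A (c • y) j = c * rs A y j := by
  simp only [rs, Pi.smul_apply, smul_eq_mul, Finset.mul_sum]
  exact Finset.sum_congr rfl fun i _ => by ring

lemma rs_continuous {d : ℕ} (A : Matrix (Fin d) (Fin d) ℤ) (j : Fin d) :
    Continuous fun x => rs A x j := by
  unfold rs; fun_prop

/-- The covering projection to the torus. -/
def toTorus {d : ℕ} (x : Fin d → ℝ) : Fin d → UnitAddCircle := fun i => (x i : UnitAddCircle)

lemma toTorus_mp (d : ℕ) :
    MeasurePreserving (toTorus (d := d)) (volume.restrict (cube d)) volume := by
  have h := measurePreserving_pi (fun _ : Fin d => (volume : Measure ℝ).restrict (Set.Ioc 0 1))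
    (fun _ : Fin d => (volume : Measure UnitAddCircle)) (f := fun _ => QuotientAddGroup.mk)
    (fun i => by simpa using UnitAddCircle.measurePreserving_mk 0)
  rw [← Measure.restrict_pi_pi] at h
  have h2 : (volume : Measure (Fin d → ℝ)).restrict (cube d)
      = (Measure.pi fun _ : Fin d => (volume : Measure ℝ)).restrict
        (Set.univ.pi fun _ : Fin d => Set.Ioc 0 1) := by
    rw [volume_pi]
    exact (Measure.restrict_congr_set
      (Measure.univ_pi_Ioc_ae_eq_Icc (f := fun _ : Fin d => (0:ℝ)) (g := fun _ => 1))).symm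
  rw [h2]
  exact h

/-- The torus endomorphism induced by an integer matrix. -/
def torusHom {d : ℕ} (A : Matrix (Fin d) (Fin d) ℤ) :
    (Fin d → UnitAddCircle) →+ (Fin d → UnitAddCircle) where
  toFun t j := ∑ i, A j i • t i
  map_zero' := by ext j; simp
  map_add' s t := by ext j; simp [Finset.sum_add_distrib]

lemma torusHom_toTorus {d : ℕ} (A : Matrix (Fin d) (Fin d) ℤ) (x : Fin d → ℝ) :
    torusHom A (toTorus x) = toTorus (rs A x) := by
  ext j
  simp only [torusHom, toTorus, rs, AddMonoidHom.coe_mk, ZeroHom.coe_mk]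
  have := (map_sum (QuotientAddGroup.mk' (AddSubgroup.zmultiples (1:ℝ)))
    (fun i => (A j i : ℝ) * x i) Finset.univ).symm
  refine Eq.trans ?_ this
  refine Finset.sum_congr rfl fun i _ => ?_
  rw [← zsmul_eq_mul, map_zsmul]
  rfl

lemma toTorus_surj (d : ℕ) : Function.Surjective (toTorus (d := d)) := by
  intro t
  choose x hx using fun i => QuotientAddGroup.mk_surjective (t i)
  exact ⟨x, funext hx⟩

lemma torusHom_mp {d : ℕ} {A : Matrix (Fin d) (Fin d) ℤ} (hA : A.det ≠ 0) :
    MeasurePreserving (torusHom A) volume volume := by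
  refine AddMonoidHom.measurePreserving ?_ ?_ rfl
  · refine continuous_pi fun j => ?_
    change Continuous fun t : Fin d → UnitAddCircle => ∑ i, A j i • t i
    fun_prop
  · intro t
    obtain ⟨y, rfl⟩ := toTorus_surj d t
    obtain ⟨x, rfl⟩ := rs_surj hA y
    exact ⟨toTorus x, torusHom_toTorus A x⟩

lemma volume_pre {d : ℕ} {A : Matrix (Fin d) (Fin d) ℤ} (hA : A.det ≠ 0)
    (B : Fin d → Set UnitAddCircle) (hB : ∀ j, MeasurableSet (B j)) :
    (volume.restrict (cube d)) {x | ∀ j, ((rs A x j : ℝ) : UnitAddCircle) ∈ B j}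
      = ∏ j, volume (B j) := by
  have h := (torusHom_mp hA).comp (toTorus_mp d)
  have h3 := h.measure_preimage (s := Set.univ.pi B)
    (MeasurableSet.univ_pi hB).nullMeasurableSet
  rw [volume_pi_pi] at h3
  rw [← h3]
  congr 1
  ext x
  simp only [Set.mem_ofPred_eq, Set.mem_preimage, Function.comp, torusHom_toTorus, Set.mem_pi,
    Set.mem_univ, true_imp_iff]
  rfl

/-! ### Frames -/

/-- `(i₀, A)` is a frame for the line `S`: all rows of `A` except `i₀` annihilate `S`. -/
def IsFrame {d : ℕ} (S : Submodule ℝ (Fin d → ℝ))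
    (p : Fin d × Matrix (Fin d) (Fin d) ℤ) : Prop :=
  p.2.det ≠ 0 ∧ ∀ j, j ≠ p.1 → ∀ v ∈ S, rs p.2 v j = 0

/-- Real version of an integer vector. -/
def rv {d : ℕ} (k : Fin d → ℤ) : Fin d → ℝ := fun i => (k i : ℝ)

lemma rv_ne {d : ℕ} {k : Fin d → ℤ} (hk : k ≠ 0) : rv k ≠ 0 := by
  intro h
  apply hk
  ext i
  have := congrFun h i
  simpa [rv] using this

lemma exists_frame {d : ℕ} {k : Fin d → ℤ} (hk : k ≠ 0) :
    ∃ p, IsFrame (Submodule.span ℝ {rv k}) p := by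
  obtain ⟨i₀, hi₀⟩ := Function.ne_iff.mp hk
  simp only [Pi.zero_apply] at hi₀
  have hi₀' : (k i₀ : ℝ) ≠ 0 := by exact_mod_cast hi₀
  let A : Matrix (Fin d) (Fin d) ℤ := fun j =>
    if j = i₀ then Pi.single i₀ 1 else Pi.single j (k i₀) - Pi.single i₀ (k j)
  have h0 : ∀ x, rs A x i₀ = x i₀ := by
    intro x
    simp [rs, A, Pi.single_apply]
  have h1 : ∀ x j, j ≠ i₀ → rs A x j = k i₀ * x j - k j * x i₀ := by
    intro x j hj
    simp [rs, A, hj, Pi.single_apply, sub_mul, Finset.sum_sub_distrib]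
  refine ⟨(i₀, A), det_ne_of_rs ?_, ?_⟩
  · intro x hx
    have hx0 : x i₀ = 0 := (h0 x).symm.trans (hx i₀)
    ext j
    by_cases hj : j = i₀
    · rw [hj, hx0]; rfl
    · have := hx j
      rw [h1 x j hj, hx0] at this
      simpa [hi₀] using this
  · intro j hj v hv
    obtain ⟨c, rfl⟩ := Submodule.mem_span_singleton.mp hv
    change rs A _ j = 0
    rw [h1 _ j hj]
    simp [rv]; ring

lemma exists_frames {d : ℕ} (hd : 2 ≤ d) :
    ∃ fr : Submodule ℝ (Fin d → ℝ) → Fin d × Matrix (Fin d) (Fin d) ℤ,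
      ∀ k : Fin d → ℤ, k ≠ 0 →
        IsFrame (Submodule.span ℝ {rv k}) (fr (Submodule.span ℝ {rv k})) := by
  have : ∀ S : Submodule ℝ (Fin d → ℝ), ∃ p : Fin d × Matrix (Fin d) (Fin d) ℤ,
      ∀ k : Fin d → ℤ, k ≠ 0 → S = Submodule.span ℝ {rv k} → IsFrame S p := by
    intro S
    by_cases h : ∃ k : Fin d → ℤ, k ≠ 0 ∧ S = Submodule.span ℝ {rv k}
    · obtain ⟨k, hk, rfl⟩ := h
      obtain ⟨p, hp⟩ := exists_frame hk
      exact ⟨p, fun _ _ _ => hp⟩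
    · exact ⟨(⟨0, by omega⟩, 0), fun k hk hS => (h ⟨k, hk, hS⟩).elim⟩
  choose fr hfr using this
  exact ⟨fr, fun k hk => hfr _ k hk rfl⟩

lemma frame_self_ne {d : ℕ} {S : Submodule ℝ (Fin d → ℝ)}
    {p : Fin d × Matrix (Fin d) (Fin d) ℤ} (hp : IsFrame S p) {v : Fin d → ℝ} (hv : v ∈ S)
    (hv0 : v ≠ 0) : rs p.2 v p.1 ≠ 0 := by
  intro h
  apply hv0
  apply rs_inj hp.1
  intro j
  by_cases hj : j = p.1
  · rw [hj, h]
  · exact hp.2 j hj v hv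

/-- A vector annihilated by all rows but `i₀` is in the line. -/
lemma frame_mem {d : ℕ} {S : Submodule ℝ (Fin d → ℝ)}
    {p : Fin d × Matrix (Fin d) (Fin d) ℤ} (hp : IsFrame S p) {v : Fin d → ℝ} (hv : v ∈ S)
    (hv0 : v ≠ 0) {w : Fin d → ℝ} (hw : ∀ j, j ≠ p.1 → rs p.2 w j = 0) :
    ∃ c : ℝ, w = c • v := by
  have hne := frame_self_ne hp hv hv0
  refine ⟨rs p.2 w p.1 / rs p.2 v p.1, ?_⟩
  rw [← sub_eq_zero]
  apply rs_inj hp.1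
  intro j
  rw [sub_eq_add_neg, ← neg_smul, rs_add, rs_smul]
  by_cases hj : j = p.1
  · rw [hj]; field_simp; ring
  · rw [hw j hj, hp.2 j hj v hv]; ring

lemma exists_cross {d : ℕ} {k k' : Fin d → ℤ} (hk : k ≠ 0) (hk' : k' ≠ 0)
    (hne : Submodule.span ℝ {rv k} ≠ Submodule.span ℝ {rv k'})
    {p p' : Fin d × Matrix (Fin d) (Fin d) ℤ}
    (hp : IsFrame (Submodule.span ℝ {rv k}) p) (hp' : IsFrame (Submodule.span ℝ {rv k'}) p') :
    ∃ j', j' ≠ p'.1 ∧ (p.2.updateRow p.1 (p'.2 j')).det ≠ 0 := by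
  have hm : rv k ∈ Submodule.span ℝ {rv k} := Submodule.mem_span_singleton_self _
  have hm' : rv k' ∈ Submodule.span ℝ {rv k'} := Submodule.mem_span_singleton_self _
  have : ∃ j', j' ≠ p'.1 ∧ rs p'.2 (rv k) j' ≠ 0 := by
    by_contra! hcon
    obtain ⟨c, hc⟩ := frame_mem hp' hm' (rv_ne hk') hcon
    have hc0 : c ≠ 0 := by
      rintro rfl
      exact rv_ne hk (by simpa using hc)
    apply hne
    rw [hc]
    exact Submodule.span_singleton_smul_eq (isUnit_iff_ne_zero.mpr hc0) _
  obtain ⟨j', hj', hz⟩ := this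
  refine ⟨j', hj', det_ne_of_rs ?_⟩
  intro x hx
  obtain ⟨c, hc⟩ := frame_mem hp hm (rv_ne hk) (w := x) (by
    intro j hj
    have := hx j
    simpa [rs, Matrix.updateRow_apply, hj] using this)
  have h2 : rs p'.2 x j' = 0 := by
    have := hx p.1
    simpa [rs, Matrix.updateRow_apply] using this
  rw [hc, rs_smul] at h2
  have : c = 0 := by simpa [hz] using h2
  rw [hc, this, zero_smul]

/-! ### The periodized bump -/

/-- A fixed bump function on `ℝ^d`. -/
def bmp (d : ℕ) : ContDiffBump (0 : Fin d → ℝ) := ⟨1 / 8, 1 / 4, by norm_num, by norm_num⟩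

lemma bmp_zero {d : ℕ} {y : Fin d → ℝ} (j : Fin d) (h : 1 / 4 ≤ |y j|) : bmp d y = 0 := by
  apply (bmp d).zero_of_le_dist
  rw [dist_zero_right]
  exact h.trans (by simpa using norm_le_pi_norm y j)

lemma bmp_one {d : ℕ} {y : Fin d → ℝ} (h : ∀ j, |y j| ≤ 1 / 8) : bmp d y = 1 := by
  apply (bmp d).one_of_mem_closedBall
  rw [mem_closedBall_zero_iff]
  exact (pi_norm_le_iff_of_nonneg (by norm_num [bmp])).mpr h

lemma bmp_deriv_bound (d m : ℕ) :
    ∃ B : ℝ, 0 ≤ B ∧ ∀ y, ‖iteratedFDeriv ℝ m (bmp d) y‖ ≤ B := by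
  have hs : HasCompactSupport (iteratedFDeriv ℝ m (bmp d)) :=
    HasCompactSupport.iteratedFDeriv (bmp d).hasCompactSupport m
  have hc : Continuous (iteratedFDeriv ℝ m (bmp d)) :=
    ((bmp d).contDiff (n := m)).continuous_iteratedFDeriv le_rfl
  obtain ⟨B, hB⟩ := hs.exists_bound_of_continuous hc
  exact ⟨B, (norm_nonneg _).trans (hB 0), hB⟩

/-- The centred fractional part, coordinatewise. -/
def fracv {d : ℕ} (y : Fin d → ℝ) : Fin d → ℝ := fun j => y j - round (y j)

lemma perG_loc {d : ℕ} {μ : ℝ} (hμ : 1 ≤ μ) (y : Fin d → ℝ) :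
    ∃ n : Fin d → ℤ, (fun y' => bmp d (μ • fracv y')) =ᶠ[nhds y]
      fun y' => bmp d (μ • (y' - rv n)) := by
  refine ⟨fun j => round (y j), ?_⟩
  filter_upwards [Metric.ball_mem_nhds y (show (0:ℝ) < 1 / 4 by norm_num)] with y' hy'
  by_cases hall : ∀ j, round (y' j) = round (y j)
  · congr 2
    ext j
    simp [fracv, rv, hall j]
  · push Not at hall
    obtain ⟨j, hj⟩ := hall
    have hyj : |y' j - y j| < 1 / 4 := by
      have := (dist_le_pi_dist y' y j).trans_lt hy'
      rwa [Real.dist_eq] at this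
    have hr : |y j - round (y j)| ≤ 1 / 2 := abs_sub_round _
    have hround : |y' j - round (y' j)| ≤ |y' j - round (y j)| := round_le _ _
    have hint : (1:ℝ) ≤ |(round (y' j) : ℝ) - round (y j)| := by
      exact_mod_cast Int.one_le_abs (sub_ne_zero.mpr hj)
    have ha : 1 / 4 ≤ |y' j - round (y' j)| := by
      have h1 : (round (y' j) : ℝ) - round (y j)
        = -(y' j - round (y' j)) + (y' j - y j) + (y j - round (y j)) := by ring
      have h2 := abs_add_three (-(y' j - round (y' j))) (y' j - y j) (y j - round (y j))
      rw [← h1, abs_neg] at h2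
      linarith
    have key : ∀ t : ℝ, 1 / 4 ≤ |t| → 1 / 4 ≤ |μ * t| := by
      intro t ht
      rw [abs_mul, abs_of_nonneg (by linarith : 0 ≤ μ)]
      nlinarith [abs_nonneg t]
    rw [bmp_zero j (key _ ha), bmp_zero j (key _ (ha.trans hround))]

/-- The linear map `A` with row `i₀` erased. -/
def Lm {d : ℕ} (p : Fin d × Matrix (Fin d) (Fin d) ℤ) : (Fin d → ℝ) →L[ℝ] (Fin d → ℝ) :=
  ContinuousLinearMap.pi fun j => if j = p.1 then 0 else
    ∑ i, (p.2 j i : ℝ) • ContinuousLinearMap.proj (R := ℝ) (φ := fun _ : Fin d => ℝ) i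

lemma Lm_apply {d : ℕ} (p : Fin d × Matrix (Fin d) (Fin d) ℤ) (x : Fin d → ℝ) (j : Fin d) :
    Lm p x j = if j = p.1 then 0 else rs p.2 x j := by
  simp only [Lm, ContinuousLinearMap.coe_pi']
  split_ifs
  · rfl
  · simp [rs]

/-- The shift. -/
def shv {d : ℕ} (i₀ : Fin d) (s : ℝ) : Fin d → ℝ := fun j => if j = i₀ then 0 else s

/-- The unnormalized profile. -/
def psiT {d : ℕ} (p : Fin d × Matrix (Fin d) (Fin d) ℤ) (s μ : ℝ) (x : Fin d → ℝ) : ℝ :=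
  bmp d (μ • fracv (Lm p x - shv p.1 s))

/-- The tube. -/
def tube {d : ℕ} (p : Fin d × Matrix (Fin d) (Fin d) ℤ) (s r : ℝ) : Set (Fin d → ℝ) :=
  {x | ∀ j, j ≠ p.1 → |rs p.2 x j - s - round (rs p.2 x j - s)| ≤ r}

lemma mem_closedBall_circle (y s r : ℝ) :
    ((y : ℝ) : UnitAddCircle) ∈ Metric.closedBall ((s : ℝ) : UnitAddCircle) r ↔
      |y - s - round (y - s)| ≤ r := by
  rw [mem_closedBall_iff_norm, ← AddCircle.coe_sub, UnitAddCircle.norm_eq]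

lemma tube_eq {d : ℕ} (p : Fin d × Matrix (Fin d) (Fin d) ℤ) (s r : ℝ) :
    tube p s r = {x | ∀ j, ((rs p.2 x j : ℝ) : UnitAddCircle) ∈
      (if j = p.1 then Set.univ else Metric.closedBall ((s : ℝ) : UnitAddCircle) r :
        Set UnitAddCircle)} := by
  ext x
  simp only [tube, Set.mem_ofPred_eq]
  refine forall_congr' fun j => ?_
  by_cases hj : j = p.1
  · simp [hj]
  · simp only [hj, if_false, mem_closedBall_circle, ne_eq, not_false_eq_true, true_imp_iff]

lemma tube_measurable {d : ℕ} (p : Fin d × Matrix (Fin d) (Fin d) ℤ) (s r : ℝ) :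
    MeasurableSet (tube p s r) := by
  rw [tube_eq]
  have : {x : Fin d → ℝ | ∀ j, ((rs p.2 x j : ℝ) : UnitAddCircle) ∈
      (if j = p.1 then Set.univ else Metric.closedBall ((s : ℝ) : UnitAddCircle) r :
        Set UnitAddCircle)} = ⋂ j, (fun x => ((rs p.2 x j : ℝ) : UnitAddCircle)) ⁻¹'
      (if j = p.1 then Set.univ else Metric.closedBall ((s : ℝ) : UnitAddCircle) r) := by
    ext x; simp
  rw [this]
  refine MeasurableSet.iInter fun j => ?_
  refine IsClosed.measurableSet ?_
  refine IsClosed.preimage ?_ ?_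
  · exact (AddCircle.continuous_mk' 1).comp (rs_continuous p.2 j)
  · split_ifs
    · exact isClosed_univ
    · exact Metric.isClosed_closedBall

lemma tube_volume {d : ℕ} {p : Fin d × Matrix (Fin d) (Fin d) ℤ} (hp : p.2.det ≠ 0)
    (s : ℝ) {r : ℝ} (hr : 2 * r ≤ 1) :
    (volume.restrict (cube d)) (tube p s r) = ENNReal.ofReal (2 * r) ^ (d - 1) := by
  rw [tube_eq, volume_pre hp]
  · rw [← Finset.mul_prod_erase Finset.univ _ (Finset.mem_univ p.1)]
    rw [Finset.prod_congr rfl (g := fun _ => ENNReal.ofReal (2 * r))]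
    · simp [Finset.card_erase_of_mem]
    · intro j hj
      rw [if_neg (Finset.ne_of_mem_erase hj), AddCircle.volume_closedBall, min_eq_right hr]
  · intro j
    split_ifs
    · exact MeasurableSet.univ
    · exact Metric.isClosed_closedBall.measurableSet

lemma psiT_loc {d : ℕ} (p : Fin d × Matrix (Fin d) (Fin d) ℤ) (s : ℝ) {μ : ℝ} (hμ : 1 ≤ μ)
    (x : Fin d → ℝ) :
    ∃ n : Fin d → ℤ, psiT p s μ =ᶠ[nhds x]
      (fun z => bmp d (z + (-(μ • (shv p.1 s + rv n))))) ∘ ⇑(μ • Lm p) := by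
  obtain ⟨n, hn⟩ := perG_loc hμ (Lm p x - shv p.1 s)
  refine ⟨n, ?_⟩
  have hc : Filter.Tendsto (fun x => Lm p x - shv p.1 s) (nhds x) (nhds (Lm p x - shv p.1 s)) :=
    Continuous.tendsto (by fun_prop) x
  filter_upwards [hc.eventually hn] with x' hx'
  simp only [psiT, Function.comp, hx']
  congr 1
  ext j
  simp
  ring

lemma psiT_contDiff {d : ℕ} (p : Fin d × Matrix (Fin d) (Fin d) ℤ) (s : ℝ) {μ : ℝ}
    (hμ : 1 ≤ μ) : ContDiff ℝ (⊤ : ℕ∞) (psiT p s μ) := by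
  rw [contDiff_iff_contDiffAt]
  intro x
  obtain ⟨n, hn⟩ := psiT_loc p s hμ x
  refine ContDiffAt.congr_of_eventuallyEq ?_ hn
  apply ContDiff.contDiffAt
  refine ContDiff.comp ?_ (ContinuousLinearMap.contDiff _)
  exact (bmp d).contDiff.comp (by fun_prop)

lemma psiT_deriv {d : ℕ} (p : Fin d × Matrix (Fin d) (Fin d) ℤ) (s : ℝ) {μ : ℝ}
    (hμ : 1 ≤ μ) (m : ℕ) {B : ℝ} (hB : ∀ y, ‖iteratedFDeriv ℝ m (bmp d) y‖ ≤ B)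
    (x : Fin d → ℝ) :
    ‖iteratedFDeriv ℝ m (psiT p s μ) x‖ ≤
      (tube p s (1 / (4 * μ))).indicator (fun _ => B * (μ * ‖Lm p‖) ^ m) x := by
  have hμ0 : 0 < μ := by linarith
  obtain ⟨n, hn⟩ := psiT_loc p s hμ x
  rw [(Filter.EventuallyEq.iteratedFDeriv ℝ hn m).eq_of_nhds]
  have hcd : ContDiff ℝ m (fun z => bmp d (z + (-(μ • (shv p.1 s + rv n))))) :=
    (bmp d).contDiff.comp (by fun_prop)
  rw [ContinuousLinearMap.iteratedFDeriv_comp_right _ hcd _ le_rfl]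
  rw [iteratedFDeriv_comp_add_right]
  set w := (μ • Lm p) x + (-(μ • (shv p.1 s + rv n))) with hw
  refine (ContinuousMultilinearMap.norm_compContinuousLinearMap_le _ _).trans ?_
  have hnorm : ‖μ • Lm p‖ = μ * ‖Lm p‖ := by
    rw [norm_smul, Real.norm_eq_abs, abs_of_pos hμ0]
  rw [Finset.prod_const, Finset.card_univ, Fintype.card_fin, hnorm]
  by_cases hx : x ∈ tube p s (1 / (4 * μ))
  · rw [Set.indicator_of_mem hx]
    gcongr
    exact hB w
  · rw [Set.indicator_of_notMem hx]
    have : iteratedFDeriv ℝ m (bmp d) w = 0 := by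
      by_contra hne
      have hsup := support_iteratedFDeriv_subset m (Function.mem_support.mpr hne)
      rw [(bmp d).tsupport_eq, mem_closedBall_zero_iff] at hsup
      apply hx
      intro j hj
      have h1 : |w j| ≤ 1 / 4 := by
        have := (norm_le_pi_norm w j).trans hsup
        simpa [bmp] using this
      have h2 : w j = μ * (rs p.2 x j - s - n j) := by
        simp [hw, Lm_apply, shv, rv, hj]; ring
      rw [h2, abs_mul, abs_of_pos hμ0] at h1
      refine (round_le _ (n j)).trans ?_
      rw [le_div_iff₀ (by positivity)]
      linarith
    rw [this]; simp

lemma psiT_le_one {d : ℕ} (p : Fin d × Matrix (Fin d) (Fin d) ℤ) (s μ : ℝ) (x : Fin d → ℝ) :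
    psiT p s μ x ≤ 1 := (bmp d).le_one

lemma psiT_nonneg {d : ℕ} (p : Fin d × Matrix (Fin d) (Fin d) ℤ) (s μ : ℝ) (x : Fin d → ℝ) :
    0 ≤ psiT p s μ x := (bmp d).nonneg

lemma psiT_zero {d : ℕ} (p : Fin d × Matrix (Fin d) (Fin d) ℤ) (s : ℝ) {μ : ℝ} (hμ : 1 ≤ μ)
    {x : Fin d → ℝ} (hx : x ∉ tube p s (1 / (4 * μ))) : psiT p s μ x = 0 := by
  simp only [tube, Set.mem_ofPred_eq] at hx
  push Not at hx
  obtain ⟨j, hj, h⟩ := hx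
  apply bmp_zero j
  have : (μ • fracv (Lm p x - shv p.1 s)) j
      = μ * (rs p.2 x j - s - round (rs p.2 x j - s)) := by
    simp [fracv, Lm_apply, shv, hj]
  rw [this, abs_mul, abs_of_nonneg (by linarith)]
  rw [div_lt_iff₀ (by linarith)] at h
  linarith

lemma psiT_one {d : ℕ} (p : Fin d × Matrix (Fin d) (Fin d) ℤ) (s : ℝ) {μ : ℝ} (hμ : 1 ≤ μ)
    {x : Fin d → ℝ} (hx : x ∈ tube p s (1 / (8 * μ))) : psiT p s μ x = 1 := by
  apply bmp_one
  intro j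
  by_cases hj : j = p.1
  · simp [fracv, Lm_apply, shv, hj]
  have h := hx j hj
  have : (μ • fracv (Lm p x - shv p.1 s)) j
      = μ * (rs p.2 x j - s - round (rs p.2 x j - s)) := by
    simp [fracv, Lm_apply, shv, hj]
  rw [this, abs_mul, abs_of_nonneg (by linarith)]
  rw [le_div_iff₀ (by linarith)] at h
  linarith

lemma psiT_periodic {d : ℕ} (p : Fin d × Matrix (Fin d) (Fin d) ℤ) (s μ : ℝ) :
    ZPeriodic (psiT p s μ) := by
  intro x n
  unfold psiT
  congr 2
  ext j
  simp only [fracv, Pi.sub_apply, Lm_apply]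
  split_ifs with hj
  · rfl
  · have : rs p.2 (fun i => x i + (n i : ℝ)) j
        = rs p.2 x j + ((∑ i, p.2 j i * n i : ℤ) : ℝ) := by
      simp [rs, mul_add, Finset.sum_add_distrib]
    rw [this, add_sub_right_comm, round_add_intCast]
    push_cast
    ring

lemma psiT_line {d : ℕ} {S : Submodule ℝ (Fin d → ℝ)} {p : Fin d × Matrix (Fin d) (Fin d) ℤ}
    (hp : IsFrame S p) (s μ : ℝ) {v : Fin d → ℝ} (hv : v ∈ S) (x : Fin d → ℝ) (t : ℝ) :
    psiT p s μ (x + t • v) = psiT p s μ x := by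
  have : Lm p v = 0 := by
    ext j
    rw [Lm_apply]
    split_ifs with hj
    · rfl
    · exact hp.2 j hj v hv
  simp [psiT, this]

/-! ### Normalization -/

lemma cube_compact (d : ℕ) : IsCompact (cube d) := isCompact_Icc

/-- Squared `L²` norm of the unnormalized profile. -/
def nsq {d : ℕ} (p : Fin d × Matrix (Fin d) (Fin d) ℤ) (s μ : ℝ) : ℝ :=
  ∫ x in cube d, psiT p s μ x ^ 2

lemma nsq_lower {d : ℕ} {p : Fin d × Matrix (Fin d) (Fin d) ℤ} (hp : p.2.det ≠ 0) (s : ℝ)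
    {μ : ℝ} (hμ : 1 ≤ μ) : (1 / (4 * μ)) ^ (d - 1) ≤ nsq p s μ := by
  have hμ0 : 0 < μ := by linarith
  have hr : 2 * (1 / (8 * μ)) = 1 / (4 * μ) := by field_simp; norm_num
  have hle : 1 / (4 * μ) ≤ 1 := by
    rw [div_le_one (by positivity)]; linarith
  have hv := tube_volume hp s (r := 1 / (8 * μ)) (by rw [hr]; exact hle)
  rw [hr] at hv
  have hint : Integrable (fun x => psiT p s μ x ^ 2) (volume.restrict (cube d)) :=
    (((psiT_contDiff p s hμ).continuous.pow 2).continuousOn).integrableOn_compact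
      (cube_compact d)
  have hfin : (volume.restrict (cube d)) (tube p s (1 / (8 * μ))) ≠ ⊤ := by
    rw [hv]; exact ENNReal.pow_ne_top ENNReal.ofReal_ne_top
  calc (1 / (4 * μ)) ^ (d - 1)
      = ∫ x in cube d, (tube p s (1 / (8 * μ))).indicator (fun _ => (1:ℝ)) x := by
        rw [integral_indicator_const _ (tube_measurable p s _), measureReal_def, hv]
        simp [ENNReal.toReal_pow, ENNReal.toReal_ofReal, hμ0.le]
    _ ≤ nsq p s μ := by
        refine integral_mono ?_ hint ?_
        · exact (integrable_indicator_iff (tube_measurable p s _)).mpr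
            (integrableOn_const hfin)
        · intro x
          by_cases hx : x ∈ tube p s (1 / (8 * μ))
          · simp only [Set.indicator_of_mem hx, psiT_one p s hμ hx]
            norm_num
          · simp only [Set.indicator_of_notMem hx]; positivity

/-- Normalizing amplitude. -/
def amp {d : ℕ} (p : Fin d × Matrix (Fin d) (Fin d) ℤ) (s μ : ℝ) : ℝ := (√(nsq p s μ))⁻¹

lemma amp_nonneg {d : ℕ} (p : Fin d × Matrix (Fin d) (Fin d) ℤ) (s μ : ℝ) :
    0 ≤ amp p s μ := by unfold amp; positivity

lemma amp_le {d : ℕ} (hd : 2 ≤ d) {p : Fin d × Matrix (Fin d) (Fin d) ℤ} (hp : p.2.det ≠ 0)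
    (s : ℝ) {μ : ℝ} (hμ : 1 ≤ μ) :
    amp p s μ ≤ 2 ^ (d - 1) * μ ^ (((d : ℝ) - 1) / 2) := by
  have hμ0 : 0 < μ := by linarith
  have h := nsq_lower hp s hμ
  have hpos : 0 < (1 / (4 * μ)) ^ (d - 1) := by positivity
  unfold amp
  rw [← Real.sqrt_inv]
  apply Real.sqrt_le_iff.mpr
  refine ⟨by positivity, ?_⟩
  have h2 : (nsq p s μ)⁻¹ ≤ ((1 / (4 * μ)) ^ (d - 1))⁻¹ := inv_anti₀ hpos h
  refine h2.trans (le_of_eq ?_)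
  have h3 : (μ ^ (((d : ℝ) - 1) / 2)) ^ 2 = μ ^ (d - 1) := by
    rw [← Real.rpow_natCast, ← Real.rpow_mul hμ0.le, ← Real.rpow_natCast]
    congr 1
    rw [Nat.cast_sub (by omega)]
    push_cast; ring
  rw [mul_pow, h3, ← pow_mul, mul_comm (d - 1) 2, pow_mul, ← mul_pow, ← inv_pow]
  norm_num

/-- The normalized profile. -/
def psi {d : ℕ} (p : Fin d × Matrix (Fin d) (Fin d) ℤ) (s μ : ℝ) (x : Fin d → ℝ) : ℝ :=
  amp p s μ * psiT p s μ x

lemma psi_contDiff {d : ℕ} (p : Fin d × Matrix (Fin d) (Fin d) ℤ) (s : ℝ) {μ : ℝ}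
    (hμ : 1 ≤ μ) : ContDiff ℝ (⊤ : ℕ∞) (psi p s μ) :=
  contDiff_const.mul (psiT_contDiff p s hμ)

lemma psi_sq {d : ℕ} {p : Fin d × Matrix (Fin d) (Fin d) ℤ} (hp : p.2.det ≠ 0)
    (s : ℝ) {μ : ℝ} (hμ : 1 ≤ μ) : ∫ x in cube d, psi p s μ x ^ 2 = 1 := by
  have hμ0 : 0 < μ := by linarith
  have hpos : 0 < nsq p s μ := lt_of_lt_of_le (by positivity) (nsq_lower hp s hμ)
  have : (fun x => psi p s μ x ^ 2) = fun x => amp p s μ ^ 2 * psiT p s μ x ^ 2 := by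
    ext x; simp [psi, mul_pow]
  rw [this, integral_const_mul]
  change amp p s μ ^ 2 * nsq p s μ = 1
  rw [amp, inv_pow, Real.sq_sqrt hpos.le, inv_mul_cancel₀ hpos.ne']

lemma psi_L2 {d : ℕ} {p : Fin d × Matrix (Fin d) (Fin d) ℤ} (hp : p.2.det ≠ 0)
    (s : ℝ) {μ : ℝ} (hμ : 1 ≤ μ) :
    eLpNorm (psi p s μ) 2 (volume.restrict (cube d)) = 1 := by
  have hint : Integrable (fun x => psi p s μ x ^ 2) (volume.restrict (cube d)) :=
    (((psi_contDiff p s hμ).continuous.pow 2).continuousOn).integrableOn_compact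
      (cube_compact d)
  have hm : MemLp (psi p s μ) 2 (volume.restrict (cube d)) :=
    (memLp_two_iff_integrable_sq
      (psi_contDiff p s hμ).continuous.aestronglyMeasurable).mpr hint
  rw [hm.eLpNorm_eq_integral_rpow_norm (by norm_num) (by norm_num)]
  have : (fun x => ‖psi p s μ x‖ ^ (2 : ℝ≥0∞).toReal) = fun x => psi p s μ x ^ 2 := by
    ext x
    rw [show (2 : ℝ≥0∞).toReal = ((2 : ℕ) : ℝ) by norm_num, Real.rpow_natCast]
    simp
  rw [this, psi_sq hp s hμ]
  simp

lemma elp_bound {d : ℕ} {F : Type*} [NormedAddCommGroup F] (f : (Fin d → ℝ) → F)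
    (ν : Measure (Fin d → ℝ)) (S : Set (Fin d → ℝ)) {M μ : ℝ} (hM : 0 ≤ M) (hμ : 1 ≤ μ) (n : ℕ)
    (hf : ∀ x, ‖f x‖ ≤ S.indicator (fun _ => M) x)
    (hS : ν S ≤ ENNReal.ofReal μ⁻¹ ^ n) (α : ℝ≥0∞) :
    eLpNorm f α ν ≤ ENNReal.ofReal (M * μ ^ (-((n : ℝ) / α.toReal))) := by
  have hμ0 : 0 < μ := by linarith
  have h1 : eLpNorm f α ν ≤ eLpNorm (S.indicator fun _ => M) α ν :=
    eLpNorm_mono fun x => (hf x).trans (le_abs_self _)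
  refine h1.trans ((eLpNorm_indicator_const_le M α).trans ?_)
  rw [ENNReal.ofReal_mul hM, Real.enorm_eq_ofReal hM]
  refine mul_le_mul' le_rfl ?_
  refine (ENNReal.rpow_le_rpow hS (by positivity)).trans (le_of_eq ?_)
  rw [← ENNReal.ofReal_pow (by positivity), ENNReal.ofReal_rpow_of_pos (by positivity)]
  congr 1
  rw [← Real.rpow_natCast, ← Real.rpow_mul (by positivity), Real.inv_rpow hμ0.le,
    ← Real.rpow_neg hμ0.le]
  congr 1
  ring

/-! ### Divergence -/

lemma sum_pd_eq_zero {d : ℕ} {f : (Fin d → ℝ) → ℝ} (hf : Differentiable ℝ f) (v : Fin d → ℝ)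
    (hl : ∀ x (t : ℝ), f (x + t • v) = f x) (x : Fin d → ℝ) :
    ∑ j, pd j (fun y => f y * v j) x = 0 := by
  have h1 : ∀ j, pd j (fun y => f y * v j) x = fderiv ℝ f x (v j • Pi.single j 1) := by
    intro j
    unfold pd
    rw [fderiv_mul_const (hf x)]
    simp
  simp_rw [h1]
  rw [← map_sum]
  have h2 : ∑ j, v j • (Pi.single j 1 : Fin d → ℝ) = v := by
    ext i; simp [Finset.sum_apply, Pi.single_apply]
  rw [h2]
  have h3 := (hf x).hasFDerivAt.hasLineDerivAt v
  have h4 : HasLineDerivAt ℝ f 0 x v := by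
    unfold HasLineDerivAt
    simp_rw [hl]
    exact hasDerivAt_const _ _
  exact h3.unique h4

lemma intVecNorm_pos {d : ℕ} {k : Fin d → ℤ} (hk : k ≠ 0) : 0 < intVecNorm k := by
  obtain ⟨i, hi⟩ := Function.ne_iff.mp hk
  apply Real.sqrt_pos.mpr
  apply Finset.sum_pos' (fun i _ => sq_nonneg _)
  refine ⟨i, Finset.mem_univ i, ?_⟩
  have : (k i : ℝ) ≠ 0 := by exact_mod_cast hi
  positivity

lemma unitVec_mem {d : ℕ} (k : Fin d → ℤ) : unitVec k ∈ Submodule.span ℝ {rv k} := by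
  rw [Submodule.mem_span_singleton]
  refine ⟨(intVecNorm k)⁻¹, ?_⟩
  ext i
  simp [unitVec, rv, div_eq_inv_mul]

lemma unitVec_le {d : ℕ} (k : Fin d → ℤ) (i : Fin d) : |unitVec k i| ≤ 1 := by
  unfold unitVec
  have h : |(k i : ℝ)| ≤ intVecNorm k := by
    apply Real.abs_le_sqrt
    exact Finset.single_le_sum (f := fun i => (k i : ℝ) ^ 2) (fun i _ => sq_nonneg _)
      (Finset.mem_univ i)
  rw [abs_div, abs_of_nonneg (show 0 ≤ intVecNorm k from Real.sqrt_nonneg _)]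
  exact div_le_one_of_le₀ h (Real.sqrt_nonneg _)

/-- The vector field. -/
def wf {d : ℕ} (k : Fin d → ℤ) (p : Fin d × Matrix (Fin d) (Fin d) ℤ) (s μ : ℝ)
    (x : Fin d → ℝ) : Fin d → ℝ := fun i => psi p s μ x * unitVec k i

lemma wf_deriv {d : ℕ} (k : Fin d → ℤ) (p : Fin d × Matrix (Fin d) (Fin d) ℤ) (s : ℝ) {μ : ℝ}
    (hμ : 1 ≤ μ) (m : ℕ) (x : Fin d → ℝ) :
    ‖iteratedFDeriv ℝ m (wf k p s μ) x‖ ≤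
      amp p s μ * ‖iteratedFDeriv ℝ m (psiT p s μ) x‖ := by
  let T : ℝ →L[ℝ] (Fin d → ℝ) :=
    (ContinuousLinearMap.id ℝ ℝ).smulRight (amp p s μ • unitVec k)
  have hT : wf k p s μ = T ∘ psiT p s μ := by
    ext y i
    simp [wf, T, psi]; ring
  have hTn : ‖T‖ ≤ amp p s μ := by
    refine ContinuousLinearMap.opNorm_le_bound _ (amp_nonneg p s μ) ?_
    intro t
    rw [pi_norm_le_iff_of_nonneg (mul_nonneg (amp_nonneg p s μ) (norm_nonneg _))]
    intro i
    simp only [T, ContinuousLinearMap.smulRight_apply, ContinuousLinearMap.id_apply,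
      Pi.smul_apply, smul_eq_mul, norm_mul, Real.norm_eq_abs, abs_of_nonneg (amp_nonneg p s μ)]
    have h1 := unitVec_le k i
    have h2 := mul_nonneg (amp_nonneg p s μ) (abs_nonneg t)
    nlinarith
  rw [hT]
  refine (ContinuousLinearMap.norm_iteratedFDeriv_comp_left T (N := m)
    (((psiT_contDiff p s hμ).of_le (by exact_mod_cast le_top)).contDiffAt) le_rfl).trans ?_
  gcongr

lemma shift_inj {a b N : ℕ} (ha : a ≤ N) (hb : b ≤ N) {μ : ℝ} (hμ : (N : ℝ) + 1 ≤ μ) {y : ℝ}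
    {n n' : ℤ} (h1 : |y - (a : ℝ) / (N + 1) - n| ≤ 1 / (4 * μ))
    (h2 : |y - (b : ℝ) / (N + 1) - n'| ≤ 1 / (4 * μ)) : a = b := by
  have hN : (0:ℝ) < N + 1 := by positivity
  have hμ0 : 0 < μ := lt_of_lt_of_le hN hμ
  have h3 : |(a : ℝ) / (N + 1) - b / (N + 1) + (n - n')| ≤ 1 / (2 * μ) := by
    have := abs_sub (y - (b : ℝ) / (N + 1) - n') (y - (a : ℝ) / (N + 1) - n)
    have e : y - (b : ℝ) / (N + 1) - n' - (y - (a : ℝ) / (N + 1) - n)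
      = (a : ℝ) / (N + 1) - b / (N + 1) + (n - n') := by ring
    rw [e] at this
    have e2 : 1 / (2 * μ) = 1 / (4 * μ) + 1 / (4 * μ) := by field_simp; norm_num
    linarith
  have h4 : |((a : ℤ) - b + (N + 1) * (n - n') : ℤ)| < 1 := by
    have e : (((a : ℤ) - b + (N + 1) * (n - n') : ℤ) : ℝ)
        = (N + 1) * ((a : ℝ) / (N + 1) - b / (N + 1) + (n - n')) := by
      push_cast; field_simp
    have : |(((a : ℤ) - b + (N + 1) * (n - n') : ℤ) : ℝ)| < 1 := by
      rw [e, abs_mul, abs_of_pos hN]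
      calc ((N : ℝ) + 1) * |(a : ℝ) / (N + 1) - b / (N + 1) + (n - n')|
          ≤ μ * (1 / (2 * μ)) := mul_le_mul hμ h3 (abs_nonneg _) hμ0.le
        _ = 1 / 2 := by field_simp
        _ < 1 := by norm_num
    exact_mod_cast this
  have h5 : (a : ℤ) - b + (N + 1) * (n - n') = 0 := Int.abs_lt_one_iff.mp h4
  have h6 : (a : ℤ) - b = 0 := by
    refine Int.eq_zero_of_abs_lt_dvd (m := (N : ℤ) + 1) ⟨n' - n, by linarith⟩ ?_
    rw [abs_lt]; constructor <;> omega
  omega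

lemma exists_shift {β : Type*} (Λ : Finset β) :
    ∃ e : β → ℕ, (∀ k, e k ≤ Λ.card) ∧ ∀ k ∈ Λ, ∀ k' ∈ Λ, e k = e k' → k = k' := by
  classical
  refine ⟨fun k => if h : k ∈ Λ then (Λ.equivFin ⟨k, h⟩ : ℕ) else 0, ?_, ?_⟩
  · intro k
    dsimp only
    split_ifs with h
    · exact (Λ.equivFin ⟨k, h⟩).2.le
    · exact Nat.zero_le _
  · intro k hk k' hk' h
    simp only [hk, hk', dif_pos] at h
    have := Λ.equivFin.injective (Fin.ext h)
    exact congrArg Subtype.val this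

/-- **Existence of stationary Mikado flows.**
Let `d ≥ 2` and `Λ ⊂ ℤ^d \ {0}` finite.  There are constants `C (m) (α) > 0` and `μ₀ ≥ 1`
such that for every `μ ≥ μ₀` there is a family of smooth divergence-free vector fields
`W_k = Ψ_k e_k` on `𝕋^d` (`k ∈ Λ`) with `div(W_k ⊗ W_k) = 0`,
`∫ W_k ⊗ W_k = e_k ⊗ e_k` (in particular `‖Ψ_k‖_{L²} = 1`), obeying
`‖∇^m W_k‖_{L^α} ≤ C μ^{m + (d−1)/2 − (d−1)/α}` and
`‖W_k ⊗ W_{k'}‖_{L^α} ≤ C μ^{(d−1) − d/α}` for `k ≠ k'`. -/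
theorem mikado_existence (d : ℕ) (hd : 2 ≤ d)
    (Λ : Finset (Fin d → ℤ)) (hΛ : (0 : Fin d → ℤ) ∉ Λ) :
    ∃ C : ℕ → ℝ≥0∞ → ℝ, (∀ m α, 0 < C m α) ∧
    ∃ μ₀ : ℝ, 1 ≤ μ₀ ∧
    ∀ μ : ℝ, μ₀ ≤ μ →
      ∃ (W : (Fin d → ℤ) → (Fin d → ℝ) → Fin d → ℝ)
        (Ψ : (Fin d → ℤ) → (Fin d → ℝ) → ℝ),
        (∀ k ∈ Λ,
          -- `W_k = Ψ_k e_k` with `Ψ_k` smooth on the torus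
          ContDiff ℝ (⊤ : ℕ∞) (Ψ k) ∧ ZPeriodic (Ψ k) ∧
          (∀ x i, W k x i = Ψ k x * unitVec k i) ∧
          -- (i) `div W_k = 0`
          (∀ x, ∑ j, pd j (fun y => W k y j) x = 0) ∧
          -- (ii) `div (W_k ⊗ W_k) = 0`
          (∀ x i, ∑ j, pd j (fun y => W k y i * W k y j) x = 0) ∧
          -- (iii) `∫ W_k ⊗ W_k = e_k ⊗ e_k`
          (∀ i j, (∫ x in cube d, W k x i * W k x j) = unitVec k i * unitVec k j) ∧
          -- in particular `‖Ψ_k‖_{L²(𝕋^d)} = 1`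
          eLpNorm (Ψ k) 2 (volume.restrict (cube d)) = 1 ∧
          -- (iv) `L^α` bounds on derivatives
          (∀ (m : ℕ) (α : ℝ≥0∞), 1 ≤ α →
            eLpNorm (iteratedFDeriv ℝ m (W k)) α (volume.restrict (cube d))
              ≤ ENNReal.ofReal
                  (C m α * μ ^ ((m : ℝ) + ((d : ℝ) - 1) / 2 - ((d : ℝ) - 1) / α.toReal)))) ∧
        -- (v) `L^α` bounds on products of distinct Mikado flows
        (∀ k ∈ Λ, ∀ k' ∈ Λ, k ≠ k' → ∀ α : ℝ≥0∞, 1 ≤ α →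
          eLpNorm (fun x => fun i j => W k x i * W k' x j) α (volume.restrict (cube d))
            ≤ ENNReal.ofReal (C 0 α * μ ^ (((d : ℝ) - 1) - (d : ℝ) / α.toReal))) := by
  have hk0 : ∀ k ∈ Λ, k ≠ 0 := fun k hk h => hΛ (h ▸ hk)
  obtain ⟨fr, hfr⟩ := exists_frames hd
  obtain ⟨e, heN, hinj⟩ := exists_shift Λ
  choose B hB0 hB using bmp_deriv_bound d
  let P : (Fin d → ℤ) → Fin d × Matrix (Fin d) (Fin d) ℤ := fun k => fr (Submodule.span ℝ {rv k})
  have hP : ∀ k ∈ Λ, IsFrame (Submodule.span ℝ {rv k}) (P k) := fun k hk => hfr k (hk0 k hk)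
  let s : (Fin d → ℤ) → ℝ := fun k => (e k : ℝ) / ((Λ.card : ℝ) + 1)
  let R : ℝ := ∑ k ∈ Λ, ‖Lm (P k)‖
  have hR0 : 0 ≤ R := Finset.sum_nonneg fun k _ => norm_nonneg _
  have hR : ∀ k ∈ Λ, ‖Lm (P k)‖ ≤ R := fun k hk =>
    Finset.single_le_sum (f := fun k => ‖Lm (P k)‖) (fun k _ => norm_nonneg _) hk
  have hdc : ((d - 1 : ℕ) : ℝ) = (d : ℝ) - 1 := by
    rw [Nat.cast_sub (by omega)]; simp
  refine ⟨fun m _ => 2 ^ (d - 1) * (B m * R ^ m) + (2 ^ (d - 1)) ^ 2, ?_, (Λ.card : ℝ) + 1, ?_, ?_⟩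
  · intro m _
    have := hB0 m
    positivity
  · have : (0:ℝ) ≤ Λ.card := Nat.cast_nonneg _
    linarith
  intro μ hμN
  have hμ : 1 ≤ μ := by
    have : (0:ℝ) ≤ Λ.card := Nat.cast_nonneg _
    linarith
  have hμ0 : 0 < μ := by linarith
  have hrr : 2 * (1 / (4 * μ)) ≤ μ⁻¹ := by
    rw [inv_eq_one_div, mul_one_div, div_le_div_iff₀ (by positivity) hμ0]
    linarith
  have hrr1 : 2 * (1 / (4 * μ)) ≤ 1 := hrr.trans (inv_le_one_of_one_le₀ hμ)
  refine ⟨fun k => wf k (P k) (s k) μ, fun k => psi (P k) (s k) μ, ?_, ?_⟩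
  · intro k hk
    have hp := hP k hk
    have hcd := psi_contDiff (P k) (s k) hμ
    have hline : ∀ x (t : ℝ), psi (P k) (s k) μ (x + t • unitVec k) = psi (P k) (s k) μ x := by
      intro x t
      simp only [psi, psiT_line hp (s k) μ (unitVec_mem k)]
    have hdiff : Differentiable ℝ (psi (P k) (s k) μ) := hcd.differentiable (by simp)
    refine ⟨hcd, ?_, fun x i => rfl, ?_, ?_, ?_, psi_L2 hp.1 _ hμ, ?_⟩
    · intro x n
      simp only [psi, psiT_periodic (P k) (s k) μ x n]
    · intro x
      exact sum_pd_eq_zero hdiff (unitVec k) hline x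
    · intro x i
      have := sum_pd_eq_zero (f := fun y => psi (P k) (s k) μ y * unitVec k i *
        psi (P k) (s k) μ y) ((hdiff.mul_const _).mul hdiff) (unitVec k)
        (fun x t => by simp only [hline]) x
      simpa only [wf, mul_assoc] using this
    · intro i j
      have : ∀ x, wf k (P k) (s k) μ x i * wf k (P k) (s k) μ x j
          = psi (P k) (s k) μ x ^ 2 * (unitVec k i * unitVec k j) := by
        intro x; simp only [wf]; ring
      simp_rw [this]
      rw [integral_mul_const, psi_sq hp.1 _ hμ, one_mul]
    · intro m α _
      have hamp := amp_le hd hp.1 (s k) hμ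
      set M : ℝ := 2 ^ (d - 1) * (B m * R ^ m) * μ ^ ((m : ℝ) + ((d : ℝ) - 1) / 2) with hM
      have hBm := hB0 m
      have hM0 : 0 ≤ M := by positivity
      have hb := elp_bound (iteratedFDeriv ℝ m (wf k (P k) (s k) μ))
        (volume.restrict (cube d)) (tube (P k) (s k) (1 / (4 * μ))) hM0 hμ (d - 1) ?_ ?_ α
      · refine hb.trans (ENNReal.ofReal_le_ofReal ?_)
        rw [hM, hdc, mul_assoc, ← Real.rpow_add hμ0, ← sub_eq_add_neg]
        refine mul_le_mul_of_nonneg_right ?_ (by positivity)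
        have : (0:ℝ) ≤ (2 ^ (d - 1)) ^ 2 := by positivity
        linarith
      · intro x
        refine (wf_deriv k (P k) (s k) hμ m x).trans ?_
        have h1 := psiT_deriv (P k) (s k) hμ m (hB m) x
        by_cases hx : x ∈ tube (P k) (s k) (1 / (4 * μ))
        · rw [Set.indicator_of_mem hx] at h1 ⊢
          have h2 : B m * (μ * ‖Lm (P k)‖) ^ m ≤ B m * (μ * R) ^ m := by
            have := hR k hk
            gcongr
          calc amp (P k) (s k) μ * ‖iteratedFDeriv ℝ m (psiT (P k) (s k) μ) x‖
              ≤ (2 ^ (d - 1) * μ ^ (((d : ℝ) - 1) / 2)) * (B m * (μ * R) ^ m) :=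
                mul_le_mul hamp (h1.trans h2) (norm_nonneg _) (by positivity)
            _ = M := by
                rw [hM, Real.rpow_add hμ0, Real.rpow_natCast, mul_pow]; ring
        · rw [Set.indicator_of_notMem hx] at h1 ⊢
          have : ‖iteratedFDeriv ℝ m (psiT (P k) (s k) μ) x‖ = 0 :=
            le_antisymm h1 (norm_nonneg _)
          rw [this, mul_zero]
      · rw [tube_volume hp.1 _ hrr1]
        gcongr
  · intro k hk k' hk' hne α _
    have hp := hP k hk
    have hp' := hP k' hk'
    obtain ⟨S, hS, hSm⟩ : ∃ S : Set (Fin d → ℝ),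
        (∀ x, x ∈ tube (P k) (s k) (1 / (4 * μ)) → x ∈ tube (P k') (s k') (1 / (4 * μ)) → x ∈ S) ∧
        (volume.restrict (cube d)) S ≤ ENNReal.ofReal μ⁻¹ ^ d := by
      by_cases hpar : Submodule.span ℝ {rv k} = Submodule.span ℝ {rv k'}
      · refine ⟨∅, ?_, by simp⟩
        intro x hx hx'
        have hPP : P k' = P k := by simp only [P, hpar]
        rw [hPP] at hx'
        obtain ⟨j, hj⟩ : ∃ j : Fin d, j ≠ (P k).1 := by
          have : Nontrivial (Fin d) := Fin.nontrivial_iff_two_le.mpr hd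
          exact exists_ne _
        exact (hne (hinj k hk k' hk'
          (shift_inj (heN k) (heN k') hμN (hx j hj) (hx' j hj)))).elim
      · obtain ⟨j', hj', hdet⟩ := exists_cross (hk0 k hk) (hk0 k' hk') hpar hp hp'
        have hvol := volume_pre hdet
          (fun j => Metric.closedBall
            (((if j = (P k).1 then s k' else s k : ℝ)) : UnitAddCircle) (1 / (4 * μ)))
          (fun j => Metric.isClosed_closedBall.measurableSet)
        refine ⟨_, ?_, hvol.le.trans ?_⟩
        · intro x hx hx' j
          rw [mem_closedBall_circle]
          by_cases hj : j = (P k).1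
          · have := hx' j' hj'
            simpa [hj, rs, Matrix.updateRow_apply] using this
          · have := hx j hj
            simpa [hj, rs, Matrix.updateRow_apply] using this
        · simp only [AddCircle.volume_closedBall, Finset.prod_const, Finset.card_univ,
            Fintype.card_fin, min_eq_right hrr1]
          gcongr
    have hamp := amp_le hd hp.1 (s k) hμ
    have hamp' := amp_le hd hp'.1 (s k') hμ
    set M : ℝ := (2 ^ (d - 1)) ^ 2 * μ ^ ((d : ℝ) - 1) with hM
    have hM0 : 0 ≤ M := by positivity
    have hMa : amp (P k) (s k) μ * amp (P k') (s k') μ ≤ M := by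
      calc amp (P k) (s k) μ * amp (P k') (s k') μ
          ≤ (2 ^ (d - 1) * μ ^ (((d : ℝ) - 1) / 2)) * (2 ^ (d - 1) * μ ^ (((d : ℝ) - 1) / 2)) :=
            mul_le_mul hamp hamp' (amp_nonneg _ _ _) (by positivity)
        _ = (2 ^ (d - 1)) ^ 2 * (μ ^ (((d : ℝ) - 1) / 2) * μ ^ (((d : ℝ) - 1) / 2)) := by ring
        _ = M := by rw [← Real.rpow_add hμ0, add_halves]
    have hb := elp_bound
      (fun x => fun i j => wf k (P k) (s k) μ x i * wf k' (P k') (s k') μ x j)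
      (volume.restrict (cube d)) S hM0 hμ d ?_ hSm α
    · refine hb.trans (ENNReal.ofReal_le_ofReal ?_)
      rw [hM, mul_assoc, ← Real.rpow_add hμ0, ← sub_eq_add_neg]
      refine mul_le_mul_of_nonneg_right ?_ (by positivity)
      have := hB0 0
      have : (0:ℝ) ≤ 2 ^ (d - 1) * (B 0 * R ^ 0) := by positivity
      linarith
    · intro x
      have hind : 0 ≤ S.indicator (fun _ => M) x := Set.indicator_nonneg (fun _ _ => hM0) x
      refine (pi_norm_le_iff_of_nonneg hind).mpr fun i => ?_
      refine (pi_norm_le_iff_of_nonneg hind).mpr fun j => ?_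
      by_cases hx : x ∈ S
      · rw [Set.indicator_of_mem hx]
        refine le_trans ?_ hMa
        have key : ∀ (k : Fin d → ℤ) (i : Fin d),
            |wf k (P k) (s k) μ x i| ≤ amp (P k) (s k) μ := by
          intro k i
          have h1 := psiT_le_one (P k) (s k) μ x
          have h2 := psiT_nonneg (P k) (s k) μ x
          have h3 := amp_nonneg (P k) (s k) μ
          have h4 := unitVec_le k i
          rw [wf, psi, abs_mul, abs_mul, abs_of_nonneg h3, abs_of_nonneg h2, mul_assoc]
          exact mul_le_of_le_one_right h3 (mul_le_one₀ h1 (abs_nonneg _) h4)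
        rw [Real.norm_eq_abs, abs_mul]
        exact mul_le_mul (key k i) (key k' j) (abs_nonneg _) (amp_nonneg _ _ _)
      · rw [Set.indicator_of_notMem hx]
        have hz : wf k (P k) (s k) μ x i * wf k' (P k') (s k') μ x j = 0 := by
          by_cases h1 : x ∈ tube (P k) (s k) (1 / (4 * μ))
          · have h2 : x ∉ tube (P k') (s k') (1 / (4 * μ)) := fun h => hx (hS x h1 h)
            simp [wf, psi, psiT_zero _ _ hμ h2]
          · simp [wf, psi, psiT_zero _ _ hμ h1]
        rw [hz, norm_zero]
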